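/- Let ρ_n, ρ be finite positive Borel measures on [−R,R] arising from Krein functions ξ_n, ξ via H(z) = (z+R)exp(∫ξ(t)dt/(t−z)) and the Herglotz representation H(z) = z + A + ∫dρ(t)/(t−z). If ξ_n dt → ξ dt in the weak-* topology, then H_n(z) → H(z) locally uniformly on the upper half plane, and consequently ρ_n → ρ in the weak-* topology. -/

import Mathlib

open MeasureTheory Filter Complex

/-- `ξ` is a Krein function on `(-R,R)` whose associated Herglotz function
`H(z) = (z+R)·exp(∫ ξ(t)dt/(t−z))` has Herglotz representation
`H(z) = z + A + ∫ dρ(t)/(t−z)`. -/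
def IsKreinHerglotzPair (R : ℝ) (ξ : ℝ → ℝ) (A : ℝ) (ρ : MeasureTheory.Measure ℝ) : Prop :=
  Measurable ξ ∧ (∀ t, 0 ≤ ξ t ∧ ξ t ≤ 1) ∧
  IsFiniteMeasure ρ ∧ ρ (Set.Ioo (-R) R)ᶜ = 0 ∧
  ∀ z : ℂ, 0 < z.im →
    (z + (R : ℂ)) * Complex.exp (∫ t in Set.Ioo (-R) R, (ξ t : ℂ) / ((t : ℂ) - z)) =
      z + (A : ℂ) + ∫ t, ((t : ℂ) - z)⁻¹ ∂ρ

lemma kh_norm_inv_le (z : ℂ) (hz : 0 < z.im) (t : ℝ) : ‖((t:ℂ) - z)⁻¹‖ ≤ 1 / z.im := by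
  rw [norm_inv, ← one_div]
  apply one_div_le_one_div_of_le hz
  have := Complex.abs_im_le_norm ((t:ℂ) - z)
  simp only [sub_im, ofReal_im, zero_sub, abs_neg] at this
  exact (le_abs_self _).trans this

lemma kh_ne (z : ℂ) (hz : 0 < z.im) (t : ℝ) : (t:ℂ) - z ≠ 0 := by
  intro h
  have := congrArg Complex.im h
  simp at this
  linarith

lemma kh_cont (z : ℂ) (hz : 0 < z.im) : Continuous (fun t : ℝ => ((t:ℂ) - z)⁻¹) :=
  Continuous.inv₀ (by fun_prop) (kh_ne z hz)

lemma kh_ae {R : ℝ} {μ : Measure ℝ} (hμ : μ (Set.Ioo (-R) R)ᶜ = 0) : ∀ᵐ t ∂μ, |t| ≤ R := by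
  have : ∀ᵐ t ∂μ, t ∈ Set.Ioo (-R) R := by
    rw [ae_iff]; exact hμ
  filter_upwards [this] with t ht
  exact abs_le.2 ⟨ht.1.le, ht.2.le⟩

lemma kh_bound {R : ℝ} {μ : Measure ℝ} (hμ : μ (Set.Ioo (-R) R)ᶜ = 0) (z : ℂ) (hz : 0 < z.im)
    (k : ℕ) : ∀ᵐ t : ℝ ∂μ, ‖(t:ℂ)^k * ((t:ℂ) - z)⁻¹‖ ≤ R^k * (1 / z.im) := by
  filter_upwards [kh_ae hμ] with t ht
  have hR : 0 ≤ R := (abs_nonneg t).trans ht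
  rw [norm_mul, norm_pow, Complex.norm_real, Real.norm_eq_abs]
  exact mul_le_mul (pow_le_pow_left₀ (abs_nonneg _) ht k) (kh_norm_inv_le z hz t) (norm_nonneg _)
    (by positivity)

lemma kh_int {R : ℝ} {μ : Measure ℝ} [IsFiniteMeasure μ] (hμ : μ (Set.Ioo (-R) R)ᶜ = 0)
    (z : ℂ) (hz : 0 < z.im) (k : ℕ) : Integrable (fun t : ℝ => (t:ℂ)^k * ((t:ℂ) - z)⁻¹) μ := by
  have hc := kh_cont z hz
  refine Integrable.of_bound (C := R^k * (1 / z.im)) ?_ (kh_bound hμ z hz k)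
  exact Continuous.aestronglyMeasurable (by fun_prop)

lemma kh_intf {R : ℝ} {μ : Measure ℝ} [IsFiniteMeasure μ] (hμ : μ (Set.Ioo (-R) R)ᶜ = 0)
    (f : ℝ → ℝ) (hf : Continuous f) : Integrable f μ := by
  obtain ⟨C, hC⟩ := (isCompact_Icc (a := -R) (b := R)).exists_bound_of_continuousOn hf.continuousOn
  refine Integrable.of_bound (C := C) hf.aestronglyMeasurable ?_
  filter_upwards [kh_ae hμ] with t ht
  exact hC t ⟨(abs_le.1 ht).1, (abs_le.1 ht).2⟩

lemma kh_rec {R : ℝ} {μ : Measure ℝ} [IsFiniteMeasure μ] (hμ : μ (Set.Ioo (-R) R)ᶜ = 0)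
    (z : ℂ) (hz : 0 < z.im) (k : ℕ) :
    ∫ t : ℝ, (t:ℂ)^(k+1) * ((t:ℂ) - z)⁻¹ ∂μ =
      ((∫ t : ℝ, t^k ∂μ : ℝ) : ℂ) + z * ∫ t : ℝ, (t:ℂ)^k * ((t:ℂ) - z)⁻¹ ∂μ := by
  have h1 : Integrable (fun t : ℝ => ((t^k : ℝ) : ℂ)) μ :=
    (kh_intf hμ (fun t => t^k) (by fun_prop)).ofReal
  rw [← integral_complex_ofReal, ← integral_const_mul, ← integral_add h1
    ((kh_int hμ z hz k).const_mul z)]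
  congr 1
  ext t
  have := kh_ne z hz t
  push_cast
  field_simp
  ring

lemma kh_G_le {R M : ℝ} (hR : 0 < R) {μ : Measure ℝ} [IsFiniteMeasure μ]
    (hμ : μ (Set.Ioo (-R) R)ᶜ = 0) (hM : μ.real Set.univ ≤ M) (z : ℂ) (hz : 0 < z.im) (k : ℕ) :
    ‖∫ t : ℝ, (t:ℂ)^k * ((t:ℂ) - z)⁻¹ ∂μ‖ ≤ (R^k * M) / z.im := by
  have := norm_integral_le_of_norm_le_const (kh_bound hμ z hz k)
  refine this.trans ?_
  have h0 : 0 ≤ R^k * (1/z.im) := by positivity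
  calc _ ≤ R^k * (1/z.im) * M := by gcongr
    _ = _ := by ring

lemma kh_lip {M c : ℝ} (hc : 0 < c) {μ : Measure ℝ} [IsFiniteMeasure μ]
    (hM : μ.real Set.univ ≤ M) (z w : ℂ) (hz : c ≤ z.im) (hw : c ≤ w.im) :
    ‖(∫ t : ℝ, ((t:ℂ) - z)⁻¹ ∂μ) - ∫ t : ℝ, ((t:ℂ) - w)⁻¹ ∂μ‖ ≤ (M / c^2) * ‖z - w‖ := by
  have hz0 := hc.trans_le hz
  have hw0 := hc.trans_le hw
  have key : ∀ u : ℂ, 0 < u.im → Integrable (fun t : ℝ => ((t:ℂ) - u)⁻¹) μ := fun u hu =>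
    Integrable.of_bound (C := 1 / u.im) (kh_cont u hu).aestronglyMeasurable
      (Eventually.of_forall (kh_norm_inv_le u hu))
  rw [← integral_sub (key z hz0) (key w hw0)]
  have hb : ∀ᵐ t : ℝ ∂μ, ‖((t:ℂ) - z)⁻¹ - ((t:ℂ) - w)⁻¹‖ ≤ ‖z - w‖ / c^2 := by
    refine Eventually.of_forall fun t => ?_
    have e : ((t:ℂ) - z)⁻¹ - ((t:ℂ) - w)⁻¹ = (z - w) * (((t:ℂ) - z)⁻¹ * ((t:ℂ) - w)⁻¹) := by
      have := kh_ne z hz0 t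
      have := kh_ne w hw0 t
      field_simp
      ring
    rw [e, norm_mul, norm_mul]
    have h1 : ‖((t:ℂ) - z)⁻¹‖ ≤ 1 / c :=
      (kh_norm_inv_le z hz0 t).trans (one_div_le_one_div_of_le hc hz)
    have h2 : ‖((t:ℂ) - w)⁻¹‖ ≤ 1 / c :=
      (kh_norm_inv_le w hw0 t).trans (one_div_le_one_div_of_le hc hw)
    calc _ ≤ ‖z - w‖ * (1 / c * (1 / c)) := by gcongr
      _ = _ := by ring
  refine (norm_integral_le_of_norm_le_const hb).trans ?_
  calc _ ≤ ‖z - w‖ / c^2 * M := by gcongr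
    _ = _ := by ring

lemma kh_mass {R : ℝ} {μ : Measure ℝ} [IsFiniteMeasure μ]
    (hμ : μ (Set.Ioo (-R) R)ᶜ = 0) :
    μ.real Set.univ ≤ (1 + R^2) * (∫ t : ℝ, ((t:ℂ) - I)⁻¹ ∂μ).im := by
  have hi : Integrable (fun t : ℝ => ((t:ℂ) - I)⁻¹) μ := by
    simpa using kh_int hμ I (by simp) 0
  have h1 : (∫ t : ℝ, ((t:ℂ) - I)⁻¹ ∂μ).im = ∫ t : ℝ, (((t:ℂ) - I)⁻¹).im ∂μ := by
    simpa using (integral_im hi).symm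
  rw [h1, ← integral_const_mul]
  have : μ.real Set.univ = ∫ t : ℝ, (1:ℝ) ∂μ := by simp
  rw [this]
  refine integral_mono_ae (integrable_const _) (hi.im.const_mul _) ?_
  filter_upwards [kh_ae hμ] with t ht
  have h2 : t^2 ≤ R^2 := by
    rw [← sq_abs]; exact pow_le_pow_left₀ (abs_nonneg _) ht 2
  have h3 : (((t:ℂ) - I)⁻¹).im = 1 / (1 + t^2) := by
    rw [Complex.inv_im, Complex.normSq_apply]
    simp
    ring
  change 1 ≤ (1 + R^2) * (((t:ℂ) - I)⁻¹).im
  rw [h3, mul_one_div, le_div_iff₀ (by positivity)]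
  linarith

lemma kh_lim (a : ℕ → ℂ) (l : ℂ) (C : ℝ) (b : ℝ → ℕ → ℝ)
    (hb : ∀ y, 0 < y → Tendsto (b y) atTop (nhds 0))
    (H : ∀ y, 0 < y → ∀ n, ‖a n - l‖ ≤ b y n + C / y) : Tendsto a atTop (nhds l) := by
  rw [Metric.tendsto_atTop']
  intro ε hε
  have hC : Tendsto (fun y : ℝ => C / y) atTop (nhds 0) := tendsto_const_nhds.div_atTop tendsto_id
  obtain ⟨y, hy, hy0⟩ := ((hC.eventually (gt_mem_nhds (half_pos hε))).and
    (eventually_gt_atTop 0)).exists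
  obtain ⟨N, hN⟩ := eventually_atTop.1 ((hb y hy0).eventually (gt_mem_nhds (half_pos hε)))
  refine ⟨N, fun n hn => ?_⟩
  rw [dist_eq_norm]
  have := H y hy0 n
  have := hN n hn.le
  linarith

lemma kh_moments {R M : ℝ} (hR : 0 < R) (ρn : ℕ → Measure ℝ) (ρ : Measure ℝ)
    [∀ n, IsFiniteMeasure (ρn n)] [IsFiniteMeasure ρ]
    (hsn : ∀ n, ρn n (Set.Ioo (-R) R)ᶜ = 0) (hs : ρ (Set.Ioo (-R) R)ᶜ = 0)
    (hMn : ∀ n, (ρn n).real Set.univ ≤ M) (hM : ρ.real Set.univ ≤ M)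
    (hF : ∀ z : ℂ, 0 < z.im → Tendsto (fun n => ∫ t : ℝ, ((t:ℂ) - z)⁻¹ ∂(ρn n)) atTop
      (nhds (∫ t : ℝ, ((t:ℂ) - z)⁻¹ ∂ρ))) (k : ℕ) :
    Tendsto (fun n => ∫ t : ℝ, t^k ∂(ρn n)) atTop (nhds (∫ t : ℝ, t^k ∂ρ)) := by
  have step : ∀ k : ℕ, (∀ z : ℂ, 0 < z.im →
      Tendsto (fun n => ∫ t : ℝ, (t:ℂ)^k * ((t:ℂ) - z)⁻¹ ∂(ρn n)) atTop
      (nhds (∫ t : ℝ, (t:ℂ)^k * ((t:ℂ) - z)⁻¹ ∂ρ))) →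
      Tendsto (fun n => ((∫ t : ℝ, t^k ∂(ρn n) : ℝ) : ℂ)) atTop
        (nhds ((∫ t : ℝ, t^k ∂ρ : ℝ) : ℂ)) := by
    intro k hk
    refine kh_lim _ _ (2 * (R^(k+1) * M)) (fun y n => ‖(y * I : ℂ)‖ *
      ‖(∫ t : ℝ, (t:ℂ)^k * ((t:ℂ) - y * I)⁻¹ ∂(ρn n)) - ∫ t : ℝ, (t:ℂ)^k * ((t:ℂ) - y * I)⁻¹ ∂ρ‖)
      ?_ ?_
    · intro y hy
      have := hk (y * I) (by simpa using hy)
      simpa using ((this.sub_const (∫ t : ℝ, (t:ℂ)^k * ((t:ℂ) - y * I)⁻¹ ∂ρ)).norm.const_mul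
        ‖(y * I : ℂ)‖)
    · intro y hy n
      have hz : 0 < (y * I : ℂ).im := by simpa using hy
      have e1 := kh_rec (hsn n) (y * I) hz k
      have e2 := kh_rec hs (y * I) hz k
      have b1 := kh_G_le hR (hsn n) (hMn n) (y * I) hz (k+1)
      have b2 := kh_G_le hR hs hM (y * I) hz (k+1)
      have hi : (y * I : ℂ).im = y := by simp
      rw [hi] at b1 b2
      set a := ∫ t : ℝ, (t:ℂ)^(k+1) * ((t:ℂ) - y * I)⁻¹ ∂(ρn n)
      set b := ∫ t : ℝ, (t:ℂ)^(k+1) * ((t:ℂ) - y * I)⁻¹ ∂ρ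
      rw [← norm_mul, show 2 * (R^(k+1) * M) / y = R^(k+1) * M / y + R^(k+1) * M / y by ring]
      have e3 : (((∫ t : ℝ, t^k ∂(ρn n) : ℝ) : ℂ)) - ((∫ t : ℝ, t^k ∂ρ : ℝ) : ℂ) =
        (a - b) - (y * I) * ((∫ t : ℝ, (t:ℂ)^k * ((t:ℂ) - y * I)⁻¹ ∂(ρn n)) -
          ∫ t : ℝ, (t:ℂ)^k * ((t:ℂ) - y * I)⁻¹ ∂ρ) := by
        rw [e1, e2]; ring
      rw [e3]
      have n1 := norm_sub_le (a - b) ((y * I) * ((∫ t : ℝ, (t:ℂ)^k * ((t:ℂ) - y * I)⁻¹ ∂(ρn n)) -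
          ∫ t : ℝ, (t:ℂ)^k * ((t:ℂ) - y * I)⁻¹ ∂ρ))
      have n2 := norm_sub_le a b
      linarith
  have all : ∀ k : ℕ, ∀ z : ℂ, 0 < z.im →
      Tendsto (fun n => ∫ t : ℝ, (t:ℂ)^k * ((t:ℂ) - z)⁻¹ ∂(ρn n)) atTop
      (nhds (∫ t : ℝ, (t:ℂ)^k * ((t:ℂ) - z)⁻¹ ∂ρ)) := by
    intro k
    induction k with
    | zero => simpa using hF
    | succ k ih =>
      intro z hz
      simp_rw [fun n => kh_rec (hsn n) z hz k, kh_rec hs z hz k]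
      exact (step k ih).add ((ih z hz).const_mul z)
  have := (Complex.continuous_re.tendsto _).comp (step k (all k))
  simpa [Function.comp_def] using this

lemma kh_poly {R : ℝ} (ρn : ℕ → Measure ℝ) (ρ : Measure ℝ)
    [∀ n, IsFiniteMeasure (ρn n)] [IsFiniteMeasure ρ]
    (hsn : ∀ n, ρn n (Set.Ioo (-R) R)ᶜ = 0) (hs : ρ (Set.Ioo (-R) R)ᶜ = 0)
    (hm : ∀ k : ℕ, Tendsto (fun n => ∫ t : ℝ, t^k ∂(ρn n)) atTop (nhds (∫ t : ℝ, t^k ∂ρ)))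
    (p : Polynomial ℝ) :
    Tendsto (fun n => ∫ t : ℝ, p.eval t ∂(ρn n)) atTop (nhds (∫ t : ℝ, p.eval t ∂ρ)) := by
  induction p using Polynomial.induction_on' with
  | add p q hp hq =>
    have e : ∀ (μ : Measure ℝ) [IsFiniteMeasure μ], μ (Set.Ioo (-R) R)ᶜ = 0 →
        ∫ t : ℝ, (p + q).eval t ∂μ = (∫ t : ℝ, p.eval t ∂μ) + ∫ t : ℝ, q.eval t ∂μ := by
      intro μ _ hμ
      simp_rw [Polynomial.eval_add]
      exact integral_add (kh_intf hμ _ p.continuous) (kh_intf hμ _ q.continuous)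
    simp_rw [fun n => e (ρn n) (hsn n), e ρ hs]
    exact hp.add hq
  | monomial k a =>
    simp_rw [Polynomial.eval_monomial, integral_const_mul]
    exact (hm k).const_mul a

lemma kh_weak {R M : ℝ} (hM0 : 0 ≤ M) (ρn : ℕ → Measure ℝ) (ρ : Measure ℝ)
    [∀ n, IsFiniteMeasure (ρn n)] [IsFiniteMeasure ρ]
    (hsn : ∀ n, ρn n (Set.Ioo (-R) R)ᶜ = 0) (hs : ρ (Set.Ioo (-R) R)ᶜ = 0)
    (hMn : ∀ n, (ρn n).real Set.univ ≤ M) (hM : ρ.real Set.univ ≤ M)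
    (hm : ∀ k : ℕ, Tendsto (fun n => ∫ t : ℝ, t^k ∂(ρn n)) atTop (nhds (∫ t : ℝ, t^k ∂ρ)))
    (f : ℝ → ℝ) (hf : Continuous f) :
    Tendsto (fun n => ∫ t : ℝ, f t ∂(ρn n)) atTop (nhds (∫ t : ℝ, f t ∂ρ)) := by
  rw [Metric.tendsto_atTop']
  intro ε hε
  have hδ : 0 < ε / (3 * (M + 1)) := by positivity
  obtain ⟨p, hp⟩ := exists_polynomial_near_of_continuousOn (-R) R f hf.continuousOn _ hδ
  have key : ∀ (μ : Measure ℝ) [IsFiniteMeasure μ], μ (Set.Ioo (-R) R)ᶜ = 0 →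
      μ.real Set.univ ≤ M → |(∫ t : ℝ, p.eval t ∂μ) - ∫ t, f t ∂μ| < ε / 3 := by
    intro μ _ hμ hμM
    rw [← integral_sub (kh_intf hμ _ p.continuous) (kh_intf hμ _ hf)]
    have hb : ∀ᵐ t ∂μ, ‖p.eval t - f t‖ ≤ ε / (3 * (M + 1)) := by
      filter_upwards [kh_ae hμ] with t ht
      exact (hp t ⟨(abs_le.1 ht).1, (abs_le.1 ht).2⟩).le
    have := norm_integral_le_of_norm_le_const hb
    rw [Real.norm_eq_abs] at this
    refine this.trans_lt ?_
    calc _ ≤ ε / (3 * (M + 1)) * M := by gcongr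
      _ < ε / (3 * (M + 1)) * (M + 1) := by gcongr; linarith
      _ = _ := by field_simp
  obtain ⟨N, hN⟩ := Metric.tendsto_atTop'.1 (kh_poly ρn ρ hsn hs hm p) (ε/3) (by positivity)
  refine ⟨N, fun n hn => ?_⟩
  have h1 := abs_lt.1 (key (ρn n) (hsn n) (hMn n))
  have h2 := abs_lt.1 (key ρ hs hM)
  have h3 := hN n hn
  rw [Real.dist_eq] at h3 ⊢
  have h3 := abs_lt.1 h3
  rw [abs_lt]
  constructor <;> linarith [h1.1, h1.2, h2.1, h2.2, h3.1, h3.2]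

lemma kh_cauchy (R : ℝ) (ξn : ℕ → ℝ → ℝ) (ξ : ℝ → ℝ)
    (hmn : ∀ n, Measurable (ξn n)) (hm : Measurable ξ)
    (hbn : ∀ n t, 0 ≤ ξn n t ∧ ξn n t ≤ 1) (hb : ∀ t, 0 ≤ ξ t ∧ ξ t ≤ 1)
    (hweak : ∀ f : BoundedContinuousFunction ℝ ℝ,
      Tendsto (fun n => ∫ t in Set.Ioo (-R) R, f t * ξn n t) atTop
        (nhds (∫ t in Set.Ioo (-R) R, f t * ξ t))) (z : ℂ) (hz : 0 < z.im) :
    Tendsto (fun n => ∫ t in Set.Ioo (-R) R, (ξn n t : ℂ) / ((t : ℂ) - z)) atTop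
      (nhds (∫ t in Set.Ioo (-R) R, (ξ t : ℂ) / ((t : ℂ) - z))) := by
  have hc := kh_cont z hz
  let f1 : BoundedContinuousFunction ℝ ℝ := BoundedContinuousFunction.ofNormedAddCommGroup
    (fun t : ℝ => (((t:ℂ) - z)⁻¹).re) (Complex.continuous_re.comp hc) (1 / z.im)
    (fun t => (Complex.abs_re_le_norm _).trans (kh_norm_inv_le z hz t))
  let f2 : BoundedContinuousFunction ℝ ℝ := BoundedContinuousFunction.ofNormedAddCommGroup
    (fun t : ℝ => (((t:ℂ) - z)⁻¹).im) (Complex.continuous_im.comp hc) (1 / z.im)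
    (fun t => (Complex.abs_im_le_norm _).trans (kh_norm_inv_le z hz t))
  have e : ∀ g : ℝ → ℝ, Measurable g → (∀ t, 0 ≤ g t ∧ g t ≤ 1) →
      ∫ t in Set.Ioo (-R) R, (g t : ℂ) / ((t : ℂ) - z) =
        ((∫ t in Set.Ioo (-R) R, f1 t * g t : ℝ) : ℂ) +
        ((∫ t in Set.Ioo (-R) R, f2 t * g t : ℝ) : ℂ) * I := by
    intro g hg hgb
    have hi : Integrable (fun t : ℝ => (g t : ℂ) / ((t : ℂ) - z))
        (volume.restrict (Set.Ioo (-R) R)) := by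
      refine Integrable.of_bound (C := 1 / z.im) ?_ ?_
      · simp_rw [div_eq_mul_inv]
        exact ((Complex.measurable_ofReal.comp hg).mul hc.measurable).aestronglyMeasurable
      · refine Eventually.of_forall fun t => ?_
        rw [div_eq_mul_inv, norm_mul, Complex.norm_real, Real.norm_eq_abs, abs_of_nonneg (hgb t).1]
        calc _ ≤ 1 * (1 / z.im) := mul_le_mul (hgb t).2 (kh_norm_inv_le z hz t) (norm_nonneg _)
              zero_le_one
          _ = _ := one_mul _
    rw [← integral_re_add_im hi]
    have e1 : ∀ t, RCLike.re ((g t : ℂ) / ((t : ℂ) - z)) = f1 t * g t := by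
      intro t
      change ((g t : ℂ) / ((t : ℂ) - z)).re = (((t:ℂ) - z)⁻¹).re * g t
      rw [div_eq_mul_inv, Complex.re_ofReal_mul, mul_comm]
    have e2 : ∀ t, RCLike.im ((g t : ℂ) / ((t : ℂ) - z)) = f2 t * g t := by
      intro t
      change ((g t : ℂ) / ((t : ℂ) - z)).im = (((t:ℂ) - z)⁻¹).im * g t
      rw [div_eq_mul_inv, Complex.im_ofReal_mul, mul_comm]
    simp_rw [e1, e2]
    rfl
  simp_rw [fun n => e (ξn n) (hmn n) (hbn n), e ξ hm hb]
  exact ((Complex.continuous_ofReal.tendsto _).comp (hweak f1)).add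
    (((Complex.continuous_ofReal.tendsto _).comp (hweak f2)).mul_const I)

theorem krein_weakStar_implies_herglotz_convergence (R : ℝ) (hR : 0 < R)
    (ξn : ℕ → ℝ → ℝ) (An : ℕ → ℝ) (ρn : ℕ → Measure ℝ)
    (ξ : ℝ → ℝ) (A : ℝ) (ρ : Measure ℝ)
    (hn : ∀ n, IsKreinHerglotzPair R (ξn n) (An n) (ρn n))
    (h : IsKreinHerglotzPair R ξ A ρ)
    (hweak : ∀ f : BoundedContinuousFunction ℝ ℝ,
      Tendsto (fun n => ∫ t in Set.Ioo (-R) R, f t * ξn n t) atTop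
        (nhds (∫ t in Set.Ioo (-R) R, f t * ξ t))) :
    (∀ S : Set ℂ, IsCompact S → S ⊆ {z : ℂ | 0 < z.im} →
      TendstoUniformlyOn
        (fun n z =>
          (z + (R : ℂ)) *
            Complex.exp (∫ t in Set.Ioo (-R) R, (ξn n t : ℂ) / ((t : ℂ) - z)))
        (fun z =>
          (z + (R : ℂ)) *
            Complex.exp (∫ t in Set.Ioo (-R) R, (ξ t : ℂ) / ((t : ℂ) - z)))
        atTop S) ∧
    (∀ f : BoundedContinuousFunction ℝ ℝ,
      Tendsto (fun n => ∫ t, f t ∂(ρn n)) atTop (nhds (∫ t, f t ∂ρ))) := by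

  have hfn : ∀ n, IsFiniteMeasure (ρn n) := fun n => (hn n).2.2.1
  have hfin : IsFiniteMeasure ρ := h.2.2.1
  have hsn : ∀ n, ρn n (Set.Ioo (-R) R)ᶜ = 0 := fun n => (hn n).2.2.2.1
  have hs : ρ (Set.Ioo (-R) R)ᶜ = 0 := h.2.2.2.1
  have hH : ∀ z : ℂ, 0 < z.im → Tendsto (fun n => z + (An n : ℂ) + ∫ t, ((t : ℂ) - z)⁻¹ ∂(ρn n))
      atTop (nhds (z + (A : ℂ) + ∫ t, ((t : ℂ) - z)⁻¹ ∂ρ)) := by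
    intro z hz
    simp_rw [← fun n => (hn n).2.2.2.2 z hz, ← h.2.2.2.2 z hz]
    exact ((Complex.continuous_exp.tendsto _).comp (kh_cauchy R ξn ξ (fun n => (hn n).1) h.1
      (fun n => (hn n).2.1) h.2.1 hweak z hz)).const_mul _
  obtain ⟨M, hM0, hMn, hM⟩ : ∃ M : ℝ, 0 ≤ M ∧ (∀ n, (ρn n).real Set.univ ≤ M) ∧
      ρ.real Set.univ ≤ M := by
    have h1 := (Complex.continuous_im.tendsto _).comp (hH I (by simp))
    obtain ⟨B, hB⟩ := h1.bddAbove_range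
    refine ⟨max ((1 + R^2) * (B - 1)) (ρ.real Set.univ), le_max_of_le_right measureReal_nonneg,
      fun n => le_max_of_le_left ?_, le_max_right _ _⟩
    refine (kh_mass (hsn n)).trans ?_
    have h2 : _ ≤ B := hB ⟨n, rfl⟩
    simp only [Function.comp_apply, add_im, I_im, ofReal_im, add_zero] at h2
    gcongr
    linarith
  have hA : Tendsto (fun n => (An n : ℂ)) atTop (nhds (A : ℂ)) := by
    refine kh_lim _ _ (2 * M) (fun y n =>
      ‖((y * I : ℂ) + (An n : ℂ) + ∫ t, ((t : ℂ) - (y * I : ℂ))⁻¹ ∂(ρn n)) -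
        ((y * I : ℂ) + (A : ℂ) + ∫ t, ((t : ℂ) - (y * I : ℂ))⁻¹ ∂ρ)‖) ?_ ?_
    · intro y hy
      have := hH (y * I) (by simpa using hy)
      simpa using (this.sub_const ((y * I : ℂ) + (A : ℂ) + ∫ t, ((t : ℂ) - (y * I : ℂ))⁻¹ ∂ρ)).norm
    · intro y hy n
      have hz : 0 < (y * I : ℂ).im := by simpa using hy
      have b1 := kh_G_le hR (hsn n) (hMn n) (y * I) hz 0
      have b2 := kh_G_le hR hs hM (y * I) hz 0
      have hi : (y * I : ℂ).im = y := by simp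
      rw [hi] at b1 b2
      simp only [pow_zero, one_mul] at b1 b2
      set a := ∫ t : ℝ, ((t:ℂ) - y * I)⁻¹ ∂(ρn n)
      set b := ∫ t : ℝ, ((t:ℂ) - y * I)⁻¹ ∂ρ
      have e3 : (An n : ℂ) - A = (((y * I : ℂ) + (An n : ℂ) + a) - ((y * I : ℂ) + A + b)) -
        (a - b) := by ring
      rw [show 2 * M / y = M / y + M / y by ring]
      have n1 := norm_sub_le (((y * I : ℂ) + (An n : ℂ) + a) - ((y * I : ℂ) + A + b)) (a - b)
      rw [← e3] at n1
      have n2 := norm_sub_le a b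
      linarith
  constructor
  · intro S hS hSub
    rw [← tendstoLocallyUniformlyOn_iff_tendstoUniformlyOn_of_compact hS,
      Metric.tendstoLocallyUniformlyOn_iff]
    intro ε hε x hx
    have hx0 : 0 < x.im := hSub hx
    set c := x.im / 2 with hc
    have hc0 : 0 < c := by positivity
    set L := 1 + M / c^2 with hL
    have hL0 : 0 < L := by positivity
    have hnb : {y : ℂ | c < y.im} ∈ nhds x :=
      (isOpen_lt continuous_const Complex.continuous_im).mem_nhds (by
        change c < x.im
        linarith)
    have hev := (hH x hx0)
    rw [Metric.tendsto_atTop'] at hev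
    obtain ⟨N, hN⟩ := hev (ε / 3) (by positivity)
    refine ⟨{y : ℂ | c < y.im} ∩ Metric.ball x (ε / (3 * L)), mem_nhdsWithin_of_mem_nhds
      (Filter.inter_mem hnb (Metric.ball_mem_nhds x (by positivity))), ?_⟩
    filter_upwards [eventually_gt_atTop N] with n hnN y hy
    have hyc : c < y.im := hy.1
    have hy0 : 0 < y.im := hc0.trans hyc
    have hyx : ‖y - x‖ < ε / (3 * L) := by simpa [dist_eq_norm] using hy.2
    rw [(hn n).2.2.2.2 y hy0, h.2.2.2.2 y hy0]
    have key : ∀ (μ : Measure ℝ) [IsFiniteMeasure μ] (a : ℂ), μ.real Set.univ ≤ M →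
        dist (y + a + ∫ t : ℝ, ((t : ℂ) - y)⁻¹ ∂μ) (x + a + ∫ t : ℝ, ((t : ℂ) - x)⁻¹ ∂μ)
          < ε / 3 := by
      intro μ _ a hμ
      have h1 := kh_lip hc0 hμ y x hyc.le (by linarith)
      rw [dist_eq_norm]
      have e : (y + a + ∫ t : ℝ, ((t : ℂ) - y)⁻¹ ∂μ) - (x + a + ∫ t : ℝ, ((t : ℂ) - x)⁻¹ ∂μ)
        = (y - x) + ((∫ t : ℝ, ((t : ℂ) - y)⁻¹ ∂μ) - ∫ t : ℝ, ((t : ℂ) - x)⁻¹ ∂μ) := by ring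
      rw [e]
      calc _ ≤ ‖y - x‖ + (M / c^2) * ‖y - x‖ := (norm_add_le _ _).trans (by linarith)
        _ = L * ‖y - x‖ := by rw [hL]; ring
        _ < L * (ε / (3 * L)) := by gcongr
        _ = ε / 3 := by field_simp
    have k1 := key ρ A hM
    have k2 := key (ρn n) (An n) (hMn n)
    have k3 := hN n hnN
    rw [dist_comm] at k2 k3
    have t1 := dist_triangle4 (y + (A:ℂ) + ∫ t : ℝ, ((t : ℂ) - y)⁻¹ ∂ρ)
      (x + (A:ℂ) + ∫ t : ℝ, ((t : ℂ) - x)⁻¹ ∂ρ) (x + (An n:ℂ) + ∫ t : ℝ, ((t : ℂ) - x)⁻¹ ∂(ρn n))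
      (y + (An n:ℂ) + ∫ t : ℝ, ((t : ℂ) - y)⁻¹ ∂(ρn n))
    linarith
  · intro f
    refine kh_weak hM0 ρn ρ hsn hs hMn hM ?_ f f.continuous
    refine kh_moments hR ρn ρ hsn hs hMn hM ?_
    intro z hz
    have := ((hH z hz).sub hA).sub_const z
    convert this using 2
    · ring
    · ring
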